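/- Under the standing assumptions on the family G of bimodal maps: let [γ₁,γ₂] ⊆ [α,β'], j ∈ {1,2,3} and ε > 0. For γ ∈ [γ₁,γ₂] let s_j(γ) be the unique fixed point of g_γ in the lap I_j(γ) (so s_1 = 0, s_2 = r(γ), s_3 = 1), and set λ₁ = min_{γ∈[γ₁,γ₂]} |g_γ'(s_j(γ))| and λ₂ = max_{γ∈[γ₁,γ₂]} |g_γ'(s_j(γ))| (so 1 < λ₁ ≤ λ₂, these fixed points being repelling). Let I_j(n)(γ) = {x ∈ I_j(γ) : g_γ^k(x) ∈ I_j(γ) for all 1 ≤ k ≤ n}. Then there exists N > 0 such that for all k > 0, all γ ∈ [γ₁,γ₂] and all x ∈ I_j(max(k,N))(γ): λ₁^{k(1−ε)} < |(g_γ^k)'(x)| < λ₂^{k(1+ε)}. -/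

import Mathlib

open Set

noncomputable section

/-- The bimodal itinerary alphabet: lap symbols `I1, I2, I3` and critical symbols
`C1, C2`. -/
inductive BSym : Type
  | I1 | I2 | I3 | C1 | C2
deriving DecidableEq

/-- A symbol is critical if it is `C1` or `C2`. -/
def BSym.isCrit (s : BSym) : Prop := s = BSym.C1 ∨ s = BSym.C2

/-- Numerical value implementing the symbol ordering `I1 < c1 < I2 < c2 < I3`. -/
def BSym.val : BSym → ℤ
  | BSym.I1 => 0 | BSym.C1 => 1 | BSym.I2 => 2 | BSym.C2 => 3 | BSym.I3 => 4

/-- The sign `ε` of a symbol: `ε(I1) = ε(I3) = 1`, `ε(I2) = -1`, `ε(c_j) = 0`. -/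
def BSym.sgn : BSym → ℤ
  | BSym.I1 => 1 | BSym.I2 => -1 | BSym.I3 => 1 | BSym.C1 => 0 | BSym.C2 => 0

/-- The shift `σ^k`. -/
def shiftSeq (k : ℕ) (u : ℕ → BSym) : ℕ → BSym := fun m => u (m + k)

/-- The signed lexicographic (strict) order on itineraries. -/
def bLexLt (u v : ℕ → BSym) : Prop :=
  ∃ n : ℕ, (∀ i < n, u i = v i) ∧
    (u n).val * (∏ i ∈ Finset.range n, (u i).sgn) <
      (v n).val * (∏ i ∈ Finset.range n, (v i).sgn)

/-- The signed lexicographic order `⪯` on itineraries. -/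
def bLexLe (u v : ℕ → BSym) : Prop := u = v ∨ bLexLt u v

/-- `k` is a valid position of the sequence `u`, i.e. `k < |u|`. -/
def ValidPos (u : ℕ → BSym) (k : ℕ) : Prop := ∀ i < k, ¬ (u i).isCrit

/-- A sequence of `Σ` is encoded as a function `ℕ → BSym` which, from its first critical
(terminal) symbol on, is constant. -/
def Admissible (u : ℕ → BSym) : Prop :=
  ∀ n m : ℕ, n ≤ m → (u n).isCrit → u m = u n

/-- `u` is minimal: `u ⪯ σ^k u` for all `0 ≤ k < |u|`. -/
def BMinimal (u : ℕ → BSym) : Prop :=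
  ∀ k : ℕ, ValidPos u k → bLexLe u (shiftSeq k u)

/-- Canonical (padded) form of a symbol sequence: constant from the first critical symbol
on; this implements truncation of an itinerary at the first critical hit. -/
def padSeq (u : ℕ → BSym) : ℕ → BSym := fun m =>
  letI : DecidablePred fun kk : ℕ => kk ≤ m ∧ (u kk).isCrit :=
    fun _ => Classical.propDecidable _
  letI : Decidable (∃ kk : ℕ, kk ≤ m ∧ (u kk).isCrit) := Classical.propDecidable _
  if h : ∃ kk : ℕ, kk ≤ m ∧ (u kk).isCrit then u (Nat.find h) else u m

/-- The symbol of `x` relative to the turning points `c₁ < c₂`. -/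
def sym2 (c₁ c₂ x : ℝ) : BSym :=
  if x = c₁ then BSym.C1 else if x = c₂ then BSym.C2
  else if x < c₁ then BSym.I1 else if x < c₂ then BSym.I2 else BSym.I3

/-- The itinerary of `x` under the bimodal map `g` with turning points `c₁ < c₂`,
truncated (by padding) at the first critical hit. -/
def itin2 (g : ℝ → ℝ) (c₁ c₂ x : ℝ) : ℕ → BSym :=
  padSeq fun m => sym2 c₁ c₂ (g^[m] x)

/-- The second kneading sequence `K(γ) = ι(g(c₂))`. -/
def knead2 (g : ℝ → ℝ) (c₁ c₂ : ℝ) : ℕ → BSym := itin2 g c₁ c₂ (g c₂)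

/-- The sequence `pqpqpq…`. -/
def altSeq (p q : BSym) : ℕ → BSym := fun m => if m % 2 = 0 then p else q

/-- The Schwarzian derivative `f'''/f' - (3/2) (f''/f')²`. -/
def schwarzian (f : ℝ → ℝ) (x : ℝ) : ℝ :=
  iteratedDeriv 3 f x / deriv f x - 3/2 * (iteratedDeriv 2 f x / deriv f x) ^ 2

/-- `f` is non-flat at `x`. -/
def NonFlatAt (f : ℝ → ℝ) (x : ℝ) : Prop :=
  ∃ φ : ℝ → ℝ, ∃ P : Polynomial ℝ, ∃ U ∈ nhds (0:ℝ),
    ContDiff ℝ 2 φ ∧ φ 0 = x ∧ (∀ t, deriv φ t ≠ 0) ∧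
    ∀ t ∈ U, f (φ t) = P.eval t

/-- Continuity of the family `γ ↦ F γ` on `[a,b]` with respect to the `C¹` topology. -/
def C1FamilyOn (F : ℝ → ℝ → ℝ) (a b : ℝ) : Prop :=
  ∀ γ₀ ∈ Icc a b, ∀ ε > (0:ℝ), ∃ δ > (0:ℝ), ∀ γ ∈ Icc a b, |γ - γ₀| < δ →
    ∀ x ∈ Icc (0:ℝ) 1, |F γ x - F γ₀ x| < ε ∧ |deriv (F γ) x - deriv (F γ₀) x| < ε

/-- The standing assumptions of Section 3 on the one-parameter family `G` of bimodal maps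
`g_γ`, `γ ∈ [a,b] = [α,β']`, with turning points `c₁ γ < c₂ γ` and interior fixed point
`r γ`. -/
structure StandingFamily where
  /-- left endpoint `α` of the parameter interval -/
  a : ℝ
  /-- right endpoint `β'` of the parameter interval -/
  b : ℝ
  hab : a < b
  /-- the family of maps -/
  g : ℝ → ℝ → ℝ
  /-- the first turning point -/
  c₁ : ℝ → ℝ
  /-- the second turning point -/
  c₂ : ℝ → ℝ
  /-- the unique interior fixed point -/
  r : ℝ → ℝ
  smooth : ∀ γ ∈ Icc a b, ContDiff ℝ 3 (g γ)
  crit_mem : ∀ γ ∈ Icc a b, 0 < c₁ γ ∧ c₁ γ < c₂ γ ∧ c₂ γ < 1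
  mapsTo : ∀ γ ∈ Icc a b, MapsTo (g γ) (Icc 0 1) (Icc 0 1)
  zero_fixed : ∀ γ ∈ Icc a b, g γ 0 = 0
  mono1 : ∀ γ ∈ Icc a b, StrictMonoOn (g γ) (Icc 0 (c₁ γ))
  anti2 : ∀ γ ∈ Icc a b, StrictAntiOn (g γ) (Icc (c₁ γ) (c₂ γ))
  mono3 : ∀ γ ∈ Icc a b, StrictMonoOn (g γ) (Icc (c₂ γ) 1)
  deriv_ne : ∀ γ ∈ Icc a b, ∀ x ∈ Icc (0:ℝ) 1,
    x ≠ c₁ γ → x ≠ c₂ γ → deriv (g γ) x ≠ 0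
  negSchw : ∀ γ ∈ Icc a b, ∀ x ∈ Icc (0:ℝ) 1,
    x ≠ c₁ γ → x ≠ c₂ γ → schwarzian (g γ) x < 0
  nonflat : ∀ γ ∈ Icc a b, NonFlatAt (g γ) (c₁ γ) ∧ NonFlatAt (g γ) (c₂ γ)
  contFam : C1FamilyOn g a b
  /-- the family is natural: each finite itinerary is attained as a kneading sequence of
  either critical point for only finitely many parameters -/
  natural : ∀ u : ℕ → BSym, (∃ m, (u m).isCrit) →
    {γ | γ ∈ Icc a b ∧ itin2 (g γ) (c₁ γ) (c₂ γ) (g γ (c₁ γ)) = padSeq u}.Finite ∧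
    {γ | γ ∈ Icc a b ∧ knead2 (g γ) (c₁ γ) (c₂ γ) = padSeq u}.Finite
  crit1_val : ∀ γ ∈ Icc a b, g γ (c₁ γ) = 1
  rep0 : ∀ γ ∈ Icc a b, 1 < |deriv (g γ) 0|
  fix1 : ∀ γ ∈ Icc a b, g γ 1 = 1
  rep1 : ∀ γ ∈ Icc a b, 1 < |deriv (g γ) 1|
  /-- the second kneading sequence begins with `I1 I1` -/
  kneadPrefix : ∀ γ ∈ Icc a b,
    knead2 (g γ) (c₁ γ) (c₂ γ) 0 = BSym.I1 ∧ knead2 (g γ) (c₁ γ) (c₂ γ) 1 = BSym.I1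
  /-- `r γ` is the unique fixed point in `(0,1)` and it is repelling -/
  fixed_r : ∀ γ ∈ Icc a b, r γ ∈ Ioo (0:ℝ) 1 ∧ g γ (r γ) = r γ ∧
    1 < |deriv (g γ) (r γ)| ∧ ∀ x ∈ Ioo (0:ℝ) 1, g γ x = x → x = r γ
  /-- exactly three periodic orbits of period 2, all repelling, with itineraries
  `(I1I2)^∞`, `(I1I3)^∞`, `(I2I3)^∞` -/
  period2 : ∀ γ ∈ Icc a b, ∃ p₁ p₂ p₃ : ℝ,
    (p₁ ∈ Icc (0:ℝ) 1 ∧ (g γ)^[2] p₁ = p₁ ∧ g γ p₁ ≠ p₁ ∧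
      1 < |deriv ((g γ)^[2]) p₁| ∧
      itin2 (g γ) (c₁ γ) (c₂ γ) p₁ = altSeq BSym.I1 BSym.I2) ∧
    (p₂ ∈ Icc (0:ℝ) 1 ∧ (g γ)^[2] p₂ = p₂ ∧ g γ p₂ ≠ p₂ ∧
      1 < |deriv ((g γ)^[2]) p₂| ∧
      itin2 (g γ) (c₁ γ) (c₂ γ) p₂ = altSeq BSym.I1 BSym.I3) ∧
    (p₃ ∈ Icc (0:ℝ) 1 ∧ (g γ)^[2] p₃ = p₃ ∧ g γ p₃ ≠ p₃ ∧
      1 < |deriv ((g γ)^[2]) p₃| ∧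
      itin2 (g γ) (c₁ γ) (c₂ γ) p₃ = altSeq BSym.I2 BSym.I3) ∧
    ∀ q ∈ Icc (0:ℝ) 1, (g γ)^[2] q = q → g γ q ≠ q →
      q ∈ ({p₁, g γ p₁, p₂, g γ p₂, p₃, g γ p₃} : Set ℝ)
  crit2_zero : ∀ γ ∈ Icc a b, (g γ (c₂ γ) = 0 ↔ γ = a)

/-- The second kneading sequence of the member `g_γ` of the family `G`. -/
def StandingFamily.K (G : StandingFamily) (γ : ℝ) : ℕ → BSym :=
  knead2 (G.g γ) (G.c₁ γ) (G.c₂ γ)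

/-- The laps `I_1 = [0,c₁)`, `I_2 = (c₁,c₂)`, `I_3 = (c₂,1]` of a bimodal map. -/
def lap3 (c₁ c₂ : ℝ) (j : Fin 3) : Set ℝ :=
  if j = 0 then Ico 0 c₁ else if j = 1 then Ioo c₁ c₂ else Ioc c₂ 1

/-- The unique fixed point of `g_γ` in the lap `I_j`: `s₁ = 0`, `s₂ = r(γ)`, `s₃ = 1`. -/
def StandingFamily.sfix (G : StandingFamily) (j : Fin 3) (γ : ℝ) : ℝ :=
  if j = 0 then 0 else if j = 1 then G.r γ else 1

/-- `I_j(n)(γ)`: the set of points of the lap `I_j` that stay in `I_j` under the first `n`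
iterations of `g_γ`. -/
def staySet (g : ℝ → ℝ) (L : Set ℝ) (n : ℕ) : Set ℝ :=
  {x : ℝ | ∀ k ≤ n, g^[k] x ∈ L}

/-! ### Arithmetic and general lemmas -/

theorem aux_sum (A B m : ℝ) (hBA : B < A) (N0 : ℕ) :
    ∃ N1 : ℕ, 0 < N1 ∧ ∀ N ≥ N1, ∀ k : ℕ, 0 < k → ∀ f : ℕ → ℝ,
      (∀ i < k, m ≤ f i) → (∀ i < k, i + N0 ≤ max k N → A ≤ f i) →
      (k : ℝ) * B < ∑ i ∈ Finset.range k, f i := by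
  set m' := min m A with hm'
  obtain ⟨K0, hK0⟩ := exists_nat_gt ((A - m') * N0 / (A - B))
  have hAB : 0 < A - B := by linarith
  rw [div_lt_iff₀ hAB] at hK0
  have hm'A : m' ≤ A := min_le_right _ _
  refine ⟨K0 + N0 + 1, by omega, ?_⟩
  intro N hN k hk f hf1 hf2
  have hkR : (0:ℝ) < k := by exact_mod_cast hk
  by_cases hkK : k ≤ K0
  · have : ∑ i ∈ Finset.range k, A ≤ ∑ i ∈ Finset.range k, f i := by
      apply Finset.sum_le_sum
      intro i hi
      have hi' := Finset.mem_range.1 hi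
      exact hf2 i hi' (le_trans (by omega) (le_max_right _ _))
    simp only [Finset.sum_const, Finset.card_range, nsmul_eq_mul] at this
    nlinarith
  · push Not at hkK
    have hkK' : (K0:ℝ) < k := by exact_mod_cast hkK
    have h1 : ∑ i ∈ Finset.range k, (A - (if i + N0 ≤ k then 0 else (A - m')))
        ≤ ∑ i ∈ Finset.range k, f i := by
      apply Finset.sum_le_sum
      intro i hi
      have hi' := Finset.mem_range.1 hi
      split_ifs with h
      · have := hf2 i hi' (le_trans h (le_max_left _ _)); linarith
      · have := hf1 i hi'
        have : m' ≤ m := min_le_left _ _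
        linarith
    have h2 : ∑ i ∈ Finset.range k, (if i + N0 ≤ k then (0:ℝ) else (A - m')) ≤ N0 * (A - m') := by
      have hre : ∀ i, (if i + N0 ≤ k then (0:ℝ) else (A - m'))
          = if ¬ i + N0 ≤ k then (A - m') else 0 := fun i => by split_ifs <;> simp_all
      simp only [hre]
      rw [← Finset.sum_filter, Finset.sum_const, nsmul_eq_mul]
      apply mul_le_mul_of_nonneg_right _ (by linarith)
      have hsub : (Finset.range k).filter (fun i => ¬ i + N0 ≤ k) ⊆ Finset.Ico (k - N0) k := by
        intro i hi
        simp only [Finset.mem_filter, Finset.mem_range, Finset.mem_Ico] at hi ⊢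
        omega
      have := Finset.card_le_card hsub
      rw [Nat.card_Ico] at this
      have h3 : ((Finset.range k).filter (fun i => ¬ i + N0 ≤ k)).card ≤ N0 := by omega
      exact_mod_cast h3
    rw [Finset.sum_sub_distrib] at h1
    simp only [Finset.sum_const, Finset.card_range, nsmul_eq_mul] at h1
    nlinarith

theorem deriv_iter_prod (g : ℝ → ℝ) (hg : Differentiable ℝ g) (k : ℕ) (x : ℝ) :
    deriv (g^[k]) x = ∏ i ∈ Finset.range k, deriv g (g^[i] x) := by
  induction k with
  | zero => simp
  | succ k ih =>
    rw [Function.iterate_succ', deriv_comp _ (hg _) ((hg.iterate k) x), ih,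
      Finset.prod_range_succ, mul_comm]

theorem cont_clamp (H : ℝ → ℝ → ℝ) (a b : ℝ) (hab : a ≤ b)
    (hc : ∀ γ ∈ Icc a b, Continuous (H γ))
    (hu : ∀ γ₀ ∈ Icc a b, ∀ ε > (0:ℝ), ∃ δ > (0:ℝ), ∀ γ ∈ Icc a b, |γ - γ₀| < δ →
      ∀ x ∈ Icc (0:ℝ) 1, |H γ x - H γ₀ x| < ε) :
    Continuous fun p : ℝ × ℝ =>
      H (projIcc a b hab p.1) (projIcc (0:ℝ) 1 zero_le_one p.2) := by
  have cp1 : Continuous fun p : ℝ × ℝ => ((projIcc a b hab p.1 : Icc a b) : ℝ) := by fun_prop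
  have cp2 : Continuous fun p : ℝ × ℝ =>
    ((projIcc (0:ℝ) 1 zero_le_one p.2 : Icc (0:ℝ) 1) : ℝ) := by fun_prop
  rw [continuous_iff_continuousAt]
  intro p
  rw [Metric.continuousAt_iff']
  intro e he
  have hg0 := (projIcc a b hab p.1).2
  obtain ⟨δ, hδ, h⟩ := hu _ hg0 (e/2) (by linarith)
  have e1 := Metric.continuousAt_iff'.1 (cp1.continuousAt (x := p)) δ hδ
  have e2 := Metric.continuousAt_iff'.1
    (((hc _ hg0).comp cp2).continuousAt (x := p)) (e/2) (by linarith)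
  filter_upwards [e1, e2] with q h1 h2
  rw [Real.dist_eq] at h1 h2 ⊢
  have h3 := h _ (projIcc a b hab q.1).2 h1 _ (projIcc (0:ℝ) 1 zero_le_one q.2).2
  simp only [Function.comp] at h2
  calc _ ≤ _ := abs_sub_le _ (H (projIcc a b hab p.1) (projIcc (0:ℝ) 1 zero_le_one q.2)) _
    _ < e := by linarith

theorem padSeq_eq (u : ℕ → BSym) (m : ℕ) (h : ¬ (padSeq u m).isCrit) : padSeq u m = u m := by
  classical
  unfold padSeq at h ⊢
  split_ifs with hk
  · rw [dif_pos hk] at h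
    exact absurd (@Nat.find_spec _ (fun _ => Classical.propDecidable _) hk).2 h
  · rfl

theorem itin2_sym (g : ℝ → ℝ) (c₁ c₂ x : ℝ) (m : ℕ) (s : BSym) (hs : ¬ s.isCrit)
    (h : itin2 g c₁ c₂ x m = s) : sym2 c₁ c₂ (g^[m] x) = s := by
  unfold itin2 at h
  rw [padSeq_eq _ _ (by rw [h]; exact hs)] at h
  exact h

theorem sym2_I1 {c₁ c₂ x : ℝ} (h : sym2 c₁ c₂ x = BSym.I1) : x < c₁ := by
  unfold _root_.sym2 at h
  split_ifs at h
  assumption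

theorem sym2_I3 {c₁ c₂ x : ℝ} (h : sym2 c₁ c₂ x = BSym.I3) : c₂ < x := by
  unfold _root_.sym2 at h
  split_ifs at h
  push Not at *
  exact lt_of_le_of_ne (by assumption) (Ne.symm (by assumption))

/-! ### Facts on a single map -/


theorem g_cont (G : StandingFamily) {γ : ℝ} (hγ : γ ∈ Icc G.a G.b) : Continuous (G.g γ) := (G.smooth γ hγ).continuous

theorem g_c2_lt (G : StandingFamily) {γ : ℝ} (hγ : γ ∈ Icc G.a G.b) : G.g γ (G.c₂ γ) < G.c₁ γ :=
  sym2_I1 (itin2_sym _ _ _ _ 0 BSym.I1 (by simp [BSym.isCrit]) (G.kneadPrefix γ hγ).1)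

/-- A fixed point in a subinterval of `(0,1)` is `r`. -/
theorem fix_eq (G : StandingFamily) {γ : ℝ} (hγ : γ ∈ Icc G.a G.b) {x : ℝ} (h0 : 0 < x) (h1 : x < 1) (h : G.g γ x = x) : x = G.r γ :=
  (G.fixed_r γ hγ).2.2.2 x ⟨h0, h1⟩ h

theorem r_mem (G : StandingFamily) {γ : ℝ} (hγ : γ ∈ Icc G.a G.b) : G.c₁ γ < G.r γ ∧ G.r γ < G.c₂ γ := by
  obtain ⟨h0, h12, h1⟩ := G.crit_mem γ hγ
  have hc2 := g_c2_lt G hγ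
  have hc1 := G.crit1_val γ hγ
  have hcont : ContinuousOn (fun x => G.g γ x - x) (Icc (G.c₁ γ) (G.c₂ γ)) :=
    ((g_cont G hγ).sub continuous_id).continuousOn
  obtain ⟨x, hx, hx0⟩ := intermediate_value_Ioo' h12.le hcont
    (show (0:ℝ) ∈ _ from ⟨by linarith, by linarith⟩)
  have : x = G.r γ := fix_eq G hγ (by linarith [hx.1]) (by linarith [hx.2])
    (by simp only at hx0; linarith)
  rw [← this]; exact hx

theorem lap1_gt (G : StandingFamily) {γ : ℝ} (hγ : γ ∈ Icc G.a G.b) {y : ℝ} (h0 : 0 < y) (h1 : y ≤ G.c₁ γ) : y < G.g γ y := by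
  by_contra hcon
  push Not at hcon
  obtain ⟨_, h12, h21⟩ := G.crit_mem γ hγ
  have hc1 := G.crit1_val γ hγ
  have hcont : ContinuousOn (fun x => G.g γ x - x) (Icc y (G.c₁ γ)) :=
    ((g_cont G hγ).sub continuous_id).continuousOn
  obtain ⟨x, hx, hx0⟩ := intermediate_value_Icc h1 hcont
    (show (0:ℝ) ∈ _ from ⟨by linarith, by linarith⟩)
  have := fix_eq G hγ (by linarith [hx.1]) (by linarith [hx.2])
    (show G.g γ x = x by simp only at hx0; linarith)
  linarith [hx.2, (r_mem G hγ).1]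

theorem lap3_lt (G : StandingFamily) {γ : ℝ} (hγ : γ ∈ Icc G.a G.b) {y : ℝ} (h0 : G.c₂ γ ≤ y) (h1 : y < 1) : G.g γ y < y := by
  by_contra hcon
  push Not at hcon
  obtain ⟨_, h12, h21⟩ := G.crit_mem γ hγ
  have hc2 := g_c2_lt G hγ
  have hcont : ContinuousOn (fun x => G.g γ x - x) (Icc (G.c₂ γ) y) :=
    ((g_cont G hγ).sub continuous_id).continuousOn
  obtain ⟨x, hx, hx0⟩ := intermediate_value_Icc h0 hcont
    (show (0:ℝ) ∈ _ from ⟨by linarith, by linarith⟩)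
  have := fix_eq G hγ (by linarith [hx.1]) (by linarith [hx.2])
    (show G.g γ x = x by simp only at hx0; linarith)
  linarith [hx.1, (r_mem G hγ).2]

theorem deriv_c1 (G : StandingFamily) {γ : ℝ} (hγ : γ ∈ Icc G.a G.b) : deriv (G.g γ) (G.c₁ γ) = 0 := by
  obtain ⟨h0, h12, h1⟩ := G.crit_mem γ hγ
  apply IsLocalMax.deriv_eq_zero
  filter_upwards [Icc_mem_nhds h0 (h12.trans h1)] with y hy
  rw [G.crit1_val γ hγ]
  exact (G.mapsTo γ hγ hy).2

theorem deriv_c2 (G : StandingFamily) {γ : ℝ} (hγ : γ ∈ Icc G.a G.b) : deriv (G.g γ) (G.c₂ γ) = 0 := by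
  obtain ⟨h0, h12, h1⟩ := G.crit_mem γ hγ
  apply IsLocalMin.deriv_eq_zero
  filter_upwards [Icc_mem_nhds h12 h1] with y hy
  rcases le_total y (G.c₂ γ) with h | h
  · exact (G.anti2 γ hγ).antitoneOn ⟨hy.1, h⟩ ⟨h12.le, le_rfl⟩ h
  · exact (G.mono3 γ hγ).monotoneOn ⟨le_rfl, h1.le⟩ ⟨h, hy.2⟩ h

theorem crit_of_deriv (G : StandingFamily) {γ : ℝ} (hγ : γ ∈ Icc G.a G.b) {x : ℝ} (hx : x ∈ Icc (0:ℝ) 1) (h : deriv (G.g γ) x = 0) :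
    x = G.c₁ γ ∨ x = G.c₂ γ := by
  by_contra hcon
  push Not at hcon
  exact G.deriv_ne γ hγ x hx hcon.1 hcon.2 h

/-- No genuine period-two point has its orbit in the closed middle lap. -/
theorem no_period2 (G : StandingFamily) {γ : ℝ} (hγ : γ ∈ Icc G.a G.b) {q : ℝ} (hq : q ∈ Icc (G.c₁ γ) (G.c₂ γ))
    (hgq : G.g γ q ∈ Icc (G.c₁ γ) (G.c₂ γ)) (h2 : (G.g γ)^[2] q = q) : G.g γ q = q := by
  by_contra hne
  obtain ⟨h0, h12, h1⟩ := G.crit_mem γ hγ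
  obtain ⟨p₁, p₂, p₃, ⟨_, a2, _, _, a5⟩, ⟨_, b2, _, _, b5⟩, ⟨_, d2, _, _, d5⟩, hall⟩ :=
    G.period2 γ hγ
  have hp1 : p₁ < G.c₁ γ := sym2_I1 (itin2_sym _ _ _ p₁ 0 BSym.I1 (by simp [BSym.isCrit])
    (by rw [a5]; simp [altSeq]))
  have hp2 : p₂ < G.c₁ γ := sym2_I1 (itin2_sym _ _ _ p₂ 0 BSym.I1 (by simp [BSym.isCrit])
    (by rw [b5]; simp [altSeq]))
  have hp3 : G.c₂ γ < G.g γ p₃ := sym2_I3 (itin2_sym _ _ _ p₃ 1 BSym.I3 (by simp [BSym.isCrit])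
    (by rw [d5]; simp [altSeq]))
  have hm := hall q ⟨by linarith [hq.1], by linarith [hq.2]⟩ h2 hne
  simp only [Function.iterate_succ, Function.iterate_zero, Function.comp, id] at a2 b2 d2
  simp only [mem_insert_iff, mem_singleton_iff] at hm
  obtain ⟨hq1, hq2⟩ := hq
  obtain ⟨hg1, hg2⟩ := hgq
  rcases hm with h | h | h | h | h | h
  · linarith
  · rw [h, a2] at hg1; linarith
  · linarith
  · rw [h, b2] at hg1; linarith
  · rw [h] at hg2; linarith
  · linarith


/-- Lower end of the closed lap. -/
def lapLo (j : Fin 3) (c d : ℝ) : ℝ := if j = 0 then 0 else if j = 1 then c else d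
/-- Upper end of the closed lap. -/
def lapHi (j : Fin 3) (c d : ℝ) : ℝ := if j = 0 then c else if j = 1 then d else 1

theorem lap_sub (j : Fin 3) (c d x : ℝ) (hx : x ∈ lap3 c d j) :
    lapLo j c d ≤ x ∧ x ≤ lapHi j c d := by
  fin_cases j <;> simp [lap3, lapLo, lapHi] at hx ⊢ <;> constructor <;> linarith [hx.1, hx.2]


theorem deriv_ne_of_stay1 (G : StandingFamily) {γ : ℝ} (hγ : γ ∈ Icc G.a G.b) (j : Fin 3) {x : ℝ} (hx : x ∈ Icc (0:ℝ) 1)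
    (hl : lapLo j (G.c₁ γ) (G.c₂ γ) ≤ x ∧ x ≤ lapHi j (G.c₁ γ) (G.c₂ γ))
    (hl' : lapLo j (G.c₁ γ) (G.c₂ γ) ≤ G.g γ x ∧ G.g γ x ≤ lapHi j (G.c₁ γ) (G.c₂ γ)) :
    deriv (G.g γ) x ≠ 0 := by
  intro h
  obtain ⟨h0, h12, h1⟩ := G.crit_mem γ hγ
  have hc2 := g_c2_lt G hγ
  have hc1 := G.crit1_val γ hγ
  obtain ⟨l1, l2⟩ := hl
  obtain ⟨l3, l4⟩ := hl'
  rcases crit_of_deriv G hγ hx h with h | h <;> subst h <;> fin_cases j <;>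
    simp [lapLo, lapHi] at l1 l2 l3 l4 <;> linarith

theorem stay_forever (G : StandingFamily) {γ : ℝ} (hγ : γ ∈ Icc G.a G.b) (j : Fin 3) {x : ℝ}
    (hx : ∀ k, lapLo j (G.c₁ γ) (G.c₂ γ) ≤ (G.g γ)^[k] x ∧
      (G.g γ)^[k] x ≤ lapHi j (G.c₁ γ) (G.c₂ γ)) : x = G.sfix j γ := by
  obtain ⟨h0, h12, h1⟩ := G.crit_mem γ hγ
  have hc2 := g_c2_lt G hγ
  have hc1 := G.crit1_val γ hγ
  have hgc := g_cont G hγ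
  set lo := lapLo j (G.c₁ γ) (G.c₂ γ) with hlo
  set hi := lapHi j (G.c₁ γ) (G.c₂ γ) with hhi
  set S : Set ℝ := {y | ∀ k, (G.g γ)^[k] y ∈ Icc lo hi} with hS
  have hxS : x ∈ S := hx
  have hSc : IsClosed S := by
    have : S = ⋂ k, ((G.g γ)^[k]) ⁻¹' (Icc lo hi) := by ext y; simp [hS]
    rw [this]
    exact isClosed_iInter fun k => isClosed_Icc.preimage (hgc.iterate k)
  have hSsub : S ⊆ Icc lo hi := fun y hy => hy 0
  have hSK : IsCompact S := isCompact_Icc.of_isClosed_subset hSc hSsub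
  have hinv : ∀ y ∈ S, G.g γ y ∈ S := fun y hy k => by
    have := hy (k+1); rwa [Function.iterate_succ_apply] at this
  obtain ⟨m, hmS, hm⟩ := hSK.exists_isLeast ⟨x, hxS⟩
  obtain ⟨M, hMS, hM⟩ := hSK.exists_isGreatest ⟨x, hxS⟩
  have hm1 := hSsub hmS
  have hM1 := hSsub hMS
  have hxm := hm hxS
  have hxM := hM hxS
  fin_cases j
  · simp [lapLo, lapHi] at hlo hhi
    simp only [StandingFamily.sfix]
    simp only [Fin.zero_eta, if_true]
    by_contra hne
    have hxp : 0 < x := lt_of_le_of_ne (by have := (hx 0).1; simpa [hlo] using this) (Ne.symm hne)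
    have := lap1_gt G hγ (lt_of_lt_of_le hxp hxM) (by rw [← hhi]; exact hM1.2)
    linarith [hM (hinv M hMS)]
  · simp [lapLo, lapHi] at hlo hhi
    simp [StandingFamily.sfix]
    rw [hlo, hhi] at *
    obtain ⟨hr1, hr2⟩ := r_mem G hγ
    obtain ⟨hr, hrf, hrd, -⟩ := G.fixed_r γ hγ
    have hrS : G.r γ ∈ S := fun k => by
      rw [Function.iterate_fixed hrf]; exact ⟨hr1.le, hr2.le⟩
    have hmr := hm hrS
    have hrM := hM hrS
    have hmeq : m = G.r γ := by
      by_contra hne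
      have hlt : m < G.r γ := lt_of_le_of_ne hmr hne
      have hd : HasDerivAt (fun y => G.g γ (G.g γ y) - y)
          (deriv (G.g γ) (G.r γ) * deriv (G.g γ) (G.r γ) - 1) (G.r γ) := by
        have hD := ((G.smooth γ hγ).differentiable (by norm_num) (G.r γ)).hasDerivAt
        have hD' : HasDerivAt (G.g γ) (deriv (G.g γ) (G.r γ)) (G.g γ (G.r γ)) := by
          rw [hrf]; exact hD
        exact (hD'.comp _ hD).sub (hasDerivAt_id _)
      have hpos : 0 < deriv (G.g γ) (G.r γ) * deriv (G.g γ) (G.r γ) - 1 := by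
        rw [← abs_mul_abs_self]; nlinarith
      have hev : ∀ᶠ y in nhdsWithin (G.r γ) (Iio (G.r γ)), G.g γ (G.g γ y) - y < 0 := by
        have hsl := (hasDerivAt_iff_tendsto_slope.1 hd).eventually (lt_mem_nhds hpos)
        have hsl' := hsl.filter_mono (nhdsWithin_mono _
          (fun y (hy : y < G.r γ) => (ne_of_lt hy : y ≠ G.r γ)))
        filter_upwards [hsl', self_mem_nhdsWithin] with y hy hy2
        rw [slope_def_field] at hy
        have hy3 : y - G.r γ < 0 := sub_neg.2 hy2
        simp only [hrf, sub_self, sub_zero] at hy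
        by_contra hc
        push Not at hc
        have := div_nonpos_of_nonneg_of_nonpos hc hy3.le
        linarith
      have hev2 : ∀ᶠ y in nhdsWithin (G.r γ) (Iio (G.r γ)), m < y :=
        (lt_mem_nhds hlt).filter_mono nhdsWithin_le_nhds
      obtain ⟨y, ⟨hy1, hy2⟩, hy3⟩ := ((hev.and hev2).and self_mem_nhdsWithin).exists
      have hy3 : y < G.r γ := hy3
      have hcont : ContinuousOn (fun y => G.g γ (G.g γ y) - y) (Icc m y) :=
        ((hgc.comp hgc).sub continuous_id).continuousOn
      have hmm := hm (hinv _ (hinv _ hmS))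
      obtain ⟨q, hq, hq0⟩ := intermediate_value_Icc' hy2.le hcont
        (show (0:ℝ) ∈ _ from ⟨hy1.le, by linarith⟩)
      have hqI : q ∈ Icc (G.c₁ γ) (G.c₂ γ) :=
        ⟨le_trans hm1.1 hq.1, by linarith [hq.2]⟩
      have hgq : G.g γ q ∈ Icc (G.c₁ γ) (G.c₂ γ) := by
        have ha := (G.anti2 γ hγ).antitoneOn
        have e1 := ha hqI ⟨hr1.le, hr2.le⟩ (by linarith [hq.2])
        have e2 := ha hm1 hqI hq.1
        rw [hrf] at e1
        exact ⟨by linarith, by linarith [show G.g γ m ≤ G.c₂ γ from (hSsub (hinv _ hmS)).2]⟩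
      have := no_period2 G hγ hqI hgq (by
        simp only [Function.iterate_succ, Function.iterate_zero, Function.comp, id]
        simp only at hq0; linarith)
      have := fix_eq G hγ (by linarith [hqI.1]) (by linarith [hqI.2]) this
      linarith [hq.2]
    by_contra hne
    have hlt : G.r γ < x := lt_of_le_of_ne (hmeq ▸ hxm) (Ne.symm hne)
    have := G.anti2 γ hγ ⟨hr1.le, hr2.le⟩ (hSsub hxS) hlt
    rw [hrf] at this
    have := hm (hinv _ hxS)
    linarith
  · simp [lapLo, lapHi] at hlo hhi
    simp [StandingFamily.sfix]
    by_contra hne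
    have hxp : x < 1 := lt_of_le_of_ne (by have := (hx 0).2; simpa [hhi] using this) hne
    have := lap3_lt G hγ (by rw [← hlo]; exact hm1.1) (lt_of_le_of_lt hxm hxp)
    linarith [hm (hinv m hmS)]


/-! ### The compact sets -/

/-- Clamped family. -/
def FF (G : StandingFamily) (γ x : ℝ) : ℝ :=
  G.g (projIcc G.a G.b G.hab.le γ) (projIcc (0:ℝ) 1 zero_le_one x)
/-- Clamped derivative. -/
def DD (G : StandingFamily) (γ x : ℝ) : ℝ :=
  deriv (G.g (projIcc G.a G.b G.hab.le γ)) (projIcc (0:ℝ) 1 zero_le_one x)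

theorem FF_cont (G : StandingFamily) : Continuous fun p : ℝ × ℝ => FF G p.1 p.2 :=
  cont_clamp G.g G.a G.b G.hab.le (fun γ hγ => g_cont G hγ) (fun γ₀ h0 ε hε => by
    obtain ⟨δ, hδ, h⟩ := G.contFam γ₀ h0 ε hε
    exact ⟨δ, hδ, fun γ hγ hd x hx => (h γ hγ hd x hx).1⟩)

theorem DD_cont (G : StandingFamily) : Continuous fun p : ℝ × ℝ => DD G p.1 p.2 :=
  cont_clamp (fun γ => deriv (G.g γ)) G.a G.b G.hab.le
    (fun γ hγ => (G.smooth γ hγ).continuous_deriv (by norm_num)) (fun γ₀ h0 ε hε => by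
    obtain ⟨δ, hδ, h⟩ := G.contFam γ₀ h0 ε hε
    exact ⟨δ, hδ, fun γ hγ hd x hx => (h γ hγ hd x hx).2⟩)

theorem FF_eq (G : StandingFamily) {γ x : ℝ} (hγ : γ ∈ Icc G.a G.b) (hx : x ∈ Icc (0:ℝ) 1) :
    FF G γ x = G.g γ x := by
  simp [FF, projIcc_of_mem _ hγ, projIcc_of_mem _ hx]

theorem DD_eq (G : StandingFamily) {γ x : ℝ} (hγ : γ ∈ Icc G.a G.b) (hx : x ∈ Icc (0:ℝ) 1) :
    DD G γ x = deriv (G.g γ) x := by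
  simp [DD, projIcc_of_mem _ hγ, projIcc_of_mem _ hx]

theorem iter_mem (G : StandingFamily) {γ x : ℝ} (hγ : γ ∈ Icc G.a G.b) (hx : x ∈ Icc (0:ℝ) 1)
    (k : ℕ) : (G.g γ)^[k] x ∈ Icc (0:ℝ) 1 := (G.mapsTo γ hγ).iterate k hx

theorem FF_iter_eq (G : StandingFamily) {γ x : ℝ} (hγ : γ ∈ Icc G.a G.b)
    (hx : x ∈ Icc (0:ℝ) 1) (k : ℕ) : (FF G γ)^[k] x = (G.g γ)^[k] x := by
  induction k with
  | zero => rfl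
  | succ k ih =>
    rw [Function.iterate_succ_apply', Function.iterate_succ_apply', ih,
      FF_eq G hγ (iter_mem G hγ hx k)]

theorem FF_iter_cont (G : StandingFamily) (k : ℕ) :
    Continuous fun p : ℝ × ℝ => (FF G p.1)^[k] p.2 := by
  induction k with
  | zero => exact continuous_snd
  | succ k ih =>
    simp only [Function.iterate_succ_apply']
    exact (FF_cont G).comp (continuous_fst.prodMk ih)

/-- The compact set of `(γ, x, c, d)` with `c, d` the turning points and `x` staying `n` steps
in the closed lap. -/
def AA (G : StandingFamily) (j : Fin 3) (γ₁ γ₂ : ℝ) (n : ℕ) : Set (ℝ × ℝ × ℝ × ℝ) :=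
  {p | p ∈ Icc γ₁ γ₂ ×ˢ Icc (0:ℝ) 1 ×ˢ Icc (0:ℝ) 1 ×ˢ Icc (0:ℝ) 1 ∧
    DD G p.1 p.2.2.1 = 0 ∧ FF G p.1 p.2.2.1 = 1 ∧ DD G p.1 p.2.2.2 = 0 ∧
    FF G p.1 p.2.2.2 ≤ p.2.2.1 ∧
    ∀ k ≤ n, lapLo j p.2.2.1 p.2.2.2 ≤ (FF G p.1)^[k] p.2.1 ∧
      (FF G p.1)^[k] p.2.1 ≤ lapHi j p.2.2.1 p.2.2.2}

theorem AA_closed (G : StandingFamily) (j : Fin 3) (γ₁ γ₂ : ℝ) (n : ℕ) :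
    IsClosed (AA G j γ₁ γ₂ n) := by
  have hlo : Continuous fun p : ℝ × ℝ × ℝ × ℝ => lapLo j p.2.2.1 p.2.2.2 := by
    unfold lapLo; split_ifs <;> fun_prop
  have hhi : Continuous fun p : ℝ × ℝ × ℝ × ℝ => lapHi j p.2.2.1 p.2.2.2 := by
    unfold lapHi; split_ifs <;> fun_prop
  have p3 : Continuous fun p : ℝ × ℝ × ℝ × ℝ => (p.1, p.2.2.1) := by fun_prop
  have p4 : Continuous fun p : ℝ × ℝ × ℝ × ℝ => (p.1, p.2.2.2) := by fun_prop
  have p2 : Continuous fun p : ℝ × ℝ × ℝ × ℝ => (p.1, p.2.1) := by fun_prop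
  have hit : ∀ k, Continuous fun p : ℝ × ℝ × ℝ × ℝ => (FF G p.1)^[k] p.2.1 :=
    fun k => (FF_iter_cont G k).comp p2
  unfold AA
  refine IsClosed.and (isClosed_Icc.prod (isClosed_Icc.prod (isClosed_Icc.prod isClosed_Icc))) ?_
  refine IsClosed.and (isClosed_eq ((DD_cont G).comp p3) continuous_const) ?_
  refine IsClosed.and (isClosed_eq ((FF_cont G).comp p3) continuous_const) ?_
  refine IsClosed.and (isClosed_eq ((DD_cont G).comp p4) continuous_const) ?_
  refine IsClosed.and (isClosed_le ((FF_cont G).comp p4) (by fun_prop)) ?_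
  simp only [ofPred_forall]
  refine isClosed_iInter fun k => isClosed_iInter fun _ => ?_
  exact IsClosed.and (isClosed_le hlo (hit k)) (isClosed_le (hit k) hhi)

theorem AA_compact (G : StandingFamily) (j : Fin 3) (γ₁ γ₂ : ℝ) (n : ℕ) :
    IsCompact (AA G j γ₁ γ₂ n) :=
  (isCompact_Icc.prod (isCompact_Icc.prod (isCompact_Icc.prod isCompact_Icc))).of_isClosed_subset
    (AA_closed G j γ₁ γ₂ n) (fun _ hp => hp.1)

theorem AA_anti (G : StandingFamily) (j : Fin 3) (γ₁ γ₂ : ℝ) {n m : ℕ} (h : n ≤ m) :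
    AA G j γ₁ γ₂ m ⊆ AA G j γ₁ γ₂ n := by
  rintro p ⟨a1, a2, a3, a4, a5, a6⟩
  exact ⟨a1, a2, a3, a4, a5, fun k hk => a6 k (hk.trans h)⟩

theorem AA_char (G : StandingFamily) (j : Fin 3) {γ₁ γ₂ : ℝ} (h1 : G.a ≤ γ₁) (h3 : γ₂ ≤ G.b)
    {n : ℕ} {p : ℝ × ℝ × ℝ × ℝ} (hp : p ∈ AA G j γ₁ γ₂ n) :
    p.1 ∈ Icc γ₁ γ₂ ∧ p.1 ∈ Icc G.a G.b ∧ p.2.1 ∈ Icc (0:ℝ) 1 ∧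
    ∀ k ≤ n, lapLo j (G.c₁ p.1) (G.c₂ p.1) ≤ (G.g p.1)^[k] p.2.1 ∧
      (G.g p.1)^[k] p.2.1 ≤ lapHi j (G.c₁ p.1) (G.c₂ p.1) := by
  obtain ⟨γ, x, c, d⟩ := p
  obtain ⟨⟨hg, hx, hc, hd⟩, a2, a3, a4, a5, a6⟩ := hp
  simp only at *
  have hγ : γ ∈ Icc G.a G.b := ⟨h1.trans hg.1, hg.2.trans h3⟩
  rw [DD_eq G hγ hc] at a2
  rw [FF_eq G hγ hc] at a3
  rw [DD_eq G hγ hd] at a4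
  rw [FF_eq G hγ hd] at a5
  obtain ⟨h0, h12, h21⟩ := G.crit_mem γ hγ
  have hc2 := g_c2_lt G hγ
  have hc1 := G.crit1_val γ hγ
  have ec : c = G.c₁ γ := by
    rcases crit_of_deriv G hγ hc a2 with h | h
    · exact h
    · rw [h] at a3; linarith
  have ed : d = G.c₂ γ := by
    rcases crit_of_deriv G hγ hd a4 with h | h
    · rw [h] at a5; linarith
    · exact h
  subst ec ed
  refine ⟨hg, hγ, hx, fun k hk => ?_⟩
  rw [← FF_iter_eq G hγ hx]
  exact a6 k hk

theorem AA_mem (G : StandingFamily) (j : Fin 3) {γ₁ γ₂ : ℝ} (h1 : G.a ≤ γ₁) (h3 : γ₂ ≤ G.b)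
    {n : ℕ} {γ x : ℝ} (hg : γ ∈ Icc γ₁ γ₂)
    (hx : x ∈ staySet (G.g γ) (lap3 (G.c₁ γ) (G.c₂ γ) j) n) :
    (γ, x, G.c₁ γ, G.c₂ γ) ∈ AA G j γ₁ γ₂ n ∧ x ∈ Icc (0:ℝ) 1 := by
  have hγ : γ ∈ Icc G.a G.b := ⟨h1.trans hg.1, hg.2.trans h3⟩
  obtain ⟨h0, h12, h21⟩ := G.crit_mem γ hγ
  have hx0 : x ∈ Icc (0:ℝ) 1 := by
    have := hx 0 (Nat.zero_le _)
    fin_cases j <;> simp [lap3] at this <;> constructor <;> linarith [this.1, this.2]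
  have m1 : G.c₁ γ ∈ Icc (0:ℝ) 1 := ⟨by linarith, by linarith⟩
  have m2 : G.c₂ γ ∈ Icc (0:ℝ) 1 := ⟨by linarith, by linarith⟩
  refine ⟨⟨⟨hg, hx0, m1, m2⟩, ?_, ?_, ?_, ?_, ?_⟩, hx0⟩
  · simp only; rw [DD_eq G hγ m1, deriv_c1 G hγ]
  · simp only; rw [FF_eq G hγ m1, G.crit1_val γ hγ]
  · simp only; rw [DD_eq G hγ m2, deriv_c2 G hγ]
  · simp only; rw [FF_eq G hγ m2]; exact (g_c2_lt G hγ).le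
  · intro k hk
    simp only
    rw [FF_iter_eq G hγ hx0]
    exact lap_sub _ _ _ _ (hx k hk)

theorem bounds1 (G : StandingFamily) (j : Fin 3) {γ₁ γ₂ : ℝ} (h1 : G.a ≤ γ₁) (h3 : γ₂ ≤ G.b) :
    ∃ m M : ℝ, 0 < m ∧ ∀ γ ∈ Icc γ₁ γ₂,
      ∀ x ∈ staySet (G.g γ) (lap3 (G.c₁ γ) (G.c₂ γ) j) 1,
        m ≤ |deriv (G.g γ) x| ∧ |deriv (G.g γ) x| ≤ M := by
  have hcont : Continuous fun p : ℝ × ℝ × ℝ × ℝ => |DD G p.1 p.2.1| :=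
    ((DD_cont G).comp (show Continuous fun p : ℝ × ℝ × ℝ × ℝ => (p.1, p.2.1) by fun_prop)).abs
  rcases (AA G j γ₁ γ₂ 1).eq_empty_or_nonempty with he | hne
  · refine ⟨1, 1, one_pos, fun γ hg x hx => ?_⟩
    have := (AA_mem G j h1 h3 hg hx).1
    rw [he] at this; exact this.elim
  · obtain ⟨p, hp, hpm⟩ := (AA_compact G j γ₁ γ₂ 1).exists_isMinOn hne hcont.continuousOn
    obtain ⟨q, hq, hqm⟩ := (AA_compact G j γ₁ γ₂ 1).exists_isMaxOn hne hcont.continuousOn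
    refine ⟨|DD G p.1 p.2.1|, |DD G q.1 q.2.1|, ?_, fun γ hg x hx => ?_⟩
    · obtain ⟨a1, a2, a3, a4⟩ := AA_char G j h1 h3 hp
      rw [DD_eq G a2 a3]
      exact abs_pos.2 (deriv_ne_of_stay1 G a2 j a3 (a4 0 (by norm_num)) (a4 1 le_rfl))
    · obtain ⟨hm, hx0⟩ := AA_mem G j h1 h3 hg hx
      have hγ : γ ∈ Icc G.a G.b := ⟨h1.trans hg.1, hg.2.trans h3⟩
      have e1 := hpm hm
      have e2 := hqm hm
      simp only [mem_ofPred_eq] at e1 e2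
      rw [DD_eq G hγ hx0] at e1 e2
      exact ⟨e1, e2⟩

theorem boundsN (G : StandingFamily) (j : Fin 3) {γ₁ γ₂ : ℝ} (h1 : G.a ≤ γ₁) (h3 : γ₂ ≤ G.b)
    (u v : ℝ) (huv : ∀ γ ∈ Icc γ₁ γ₂, u < |deriv (G.g γ) (G.sfix j γ)| ∧
      |deriv (G.g γ) (G.sfix j γ)| < v) :
    ∃ N0 : ℕ, ∀ γ ∈ Icc γ₁ γ₂,
      ∀ x ∈ staySet (G.g γ) (lap3 (G.c₁ γ) (G.c₂ γ) j) N0,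
        u < |deriv (G.g γ) x| ∧ |deriv (G.g γ) x| < v := by
  have hcont : Continuous fun p : ℝ × ℝ × ℝ × ℝ => |DD G p.1 p.2.1| :=
    ((DD_cont G).comp (show Continuous fun p : ℝ × ℝ × ℝ × ℝ => (p.1, p.2.1) by fun_prop)).abs
  set B : Set (ℝ × ℝ × ℝ × ℝ) := (fun p : ℝ × ℝ × ℝ × ℝ => |DD G p.1 p.2.1|) ⁻¹' (Ioo u v)ᶜ with hB
  have hBc : IsClosed B := isOpen_Ioo.isClosed_compl.preimage hcont
  have key : ∃ N0, AA G j γ₁ γ₂ N0 ∩ B = ∅ := by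
    by_contra hcon
    push Not at hcon
    obtain ⟨p, hp⟩ := IsCompact.nonempty_iInter_of_sequence_nonempty_isCompact_isClosed
      (fun n => AA G j γ₁ γ₂ n ∩ B)
      (fun n => inter_subset_inter_left _ (AA_anti G j γ₁ γ₂ (Nat.le_succ n)))
      (fun n => hcon n)
      ((AA_compact G j γ₁ γ₂ 0).inter_right hBc)
      (fun n => (AA_closed G j γ₁ γ₂ n).inter hBc)
    rw [mem_iInter] at hp
    obtain ⟨a1, a2, a3, -⟩ := AA_char G j h1 h3 (hp 0).1
    have hs := stay_forever G a2 j (x := p.2.1)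
      (fun k => (AA_char G j h1 h3 (hp k).1).2.2.2 k le_rfl)
    have hb := (hp 0).2
    rw [hB, mem_preimage] at hb
    apply hb
    rw [DD_eq G a2 a3, hs]
    exact huv _ a1
  obtain ⟨N0, hN0⟩ := key
  refine ⟨N0, fun γ hg x hx => ?_⟩
  obtain ⟨hm, hx0⟩ := AA_mem G j h1 h3 hg hx
  have hγ : γ ∈ Icc G.a G.b := ⟨h1.trans hg.1, hg.2.trans h3⟩
  by_contra hc
  have : (γ, x, G.c₁ γ, G.c₂ γ) ∈ AA G j γ₁ γ₂ N0 ∩ B := by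
    refine ⟨hm, ?_⟩
    rw [hB, mem_preimage]
    simp only
    rw [DD_eq G hγ hx0]
    exact hc
  rw [hN0] at this
  exact this

theorem stay_shift (g : ℝ → ℝ) (L : Set ℝ) (n i m : ℕ) (x : ℝ) (hx : x ∈ staySet g L n)
    (h : i + m ≤ n) : g^[i] x ∈ staySet g L m := by
  intro k hk
  rw [← Function.iterate_add_apply]
  exact hx _ (by omega)

/-- Uniform derivative estimates near the repelling fixed point in a lap: if
`λ₁ = min_{γ ∈ [γ₁,γ₂]} |g_γ'(s_j(γ))|` and `λ₂ = max_{γ ∈ [γ₁,γ₂]} |g_γ'(s_j(γ))|`, then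
there is `N > 0` such that for all `k > 0`, all `γ ∈ [γ₁,γ₂]` and all
`x ∈ I_j(max(k,N))(γ)`, `λ₁^{k(1-ε)} < |(g_γ^k)'(x)| < λ₂^{k(1+ε)}`. -/
theorem derivative_growth_in_lap
    (G : StandingFamily) (γ₁ γ₂ : ℝ)
    (h1 : G.a ≤ γ₁) (h2 : γ₁ ≤ γ₂) (h3 : γ₂ ≤ G.b)
    (j : Fin 3) (ε : ℝ) (hε : 0 < ε) (lam₁ lam₂ : ℝ)
    (hlam₁ : IsLeast {y : ℝ | ∃ γ ∈ Icc γ₁ γ₂, y = |deriv (G.g γ) (G.sfix j γ)|} lam₁)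
    (hlam₂ : IsGreatest {y : ℝ | ∃ γ ∈ Icc γ₁ γ₂, y = |deriv (G.g γ) (G.sfix j γ)|} lam₂) :
    ∃ N : ℕ, 0 < N ∧ ∀ k : ℕ, 0 < k → ∀ γ ∈ Icc γ₁ γ₂,
      ∀ x ∈ staySet (G.g γ) (lap3 (G.c₁ γ) (G.c₂ γ) j) (max k N),
        lam₁ ^ ((k : ℝ) * (1 - ε)) < |deriv ((G.g γ)^[k]) x| ∧
        |deriv ((G.g γ)^[k]) x| < lam₂ ^ ((k : ℝ) * (1 + ε)) := by
  have hrep : ∀ γ ∈ Icc γ₁ γ₂, 1 < |deriv (G.g γ) (G.sfix j γ)| := by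
    intro γ hg
    have hγ : γ ∈ Icc G.a G.b := ⟨h1.trans hg.1, hg.2.trans h3⟩
    unfold StandingFamily.sfix
    split_ifs
    · exact G.rep0 γ hγ
    · exact (G.fixed_r γ hγ).2.2.1
    · exact G.rep1 γ hγ
  have hl1 : 1 < lam₁ := by
    obtain ⟨γ, hg, h⟩ := hlam₁.1
    rw [h]; exact hrep γ hg
  have hl2 : 1 < lam₂ := by
    obtain ⟨γ, hg, h⟩ := hlam₂.1
    rw [h]; exact hrep γ hg
  have hL1 : 0 < Real.log lam₁ := Real.log_pos hl1
  have hL2 : 0 < Real.log lam₂ := Real.log_pos hl2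
  have p1 : 0 < lam₁ := by linarith
  have p2 : 0 < lam₂ := by linarith
  obtain ⟨N0, hN0⟩ := boundsN G j h1 h3 (lam₁ ^ (1 - ε/2)) (lam₂ ^ (1 + ε/2)) (by
    intro γ hg
    have e1 := hlam₁.2 ⟨γ, hg, rfl⟩
    have e2 := hlam₂.2 ⟨γ, hg, rfl⟩
    refine ⟨lt_of_lt_of_le ?_ e1, lt_of_le_of_lt e2 ?_⟩
    · conv_rhs => rw [← Real.rpow_one lam₁]
      exact Real.rpow_lt_rpow_of_exponent_lt hl1 (by linarith)
    · conv_lhs => rw [← Real.rpow_one lam₂]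
      exact Real.rpow_lt_rpow_of_exponent_lt hl2 (by linarith))
  obtain ⟨m, M, hm, hmM⟩ := bounds1 G j h1 h3
  obtain ⟨Na, hNa, ha⟩ := aux_sum ((1 - ε/2) * Real.log lam₁) ((1 - ε) * Real.log lam₁)
    (Real.log m) (by nlinarith) N0
  obtain ⟨Nb, hNb, hb⟩ := aux_sum (-((1 + ε/2) * Real.log lam₂)) (-((1 + ε) * Real.log lam₂))
    (-Real.log M) (by nlinarith) N0
  refine ⟨max Na Nb, lt_of_lt_of_le hNa (le_max_left _ _), ?_⟩
  intro k hk γ hg x hx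
  have hγ : γ ∈ Icc G.a G.b := ⟨h1.trans hg.1, hg.2.trans h3⟩
  have f1 : ∀ i < k, m ≤ |deriv (G.g γ) ((G.g γ)^[i] x)| ∧
      |deriv (G.g γ) ((G.g γ)^[i] x)| ≤ M := fun i hi =>
    hmM γ hg _ (stay_shift _ _ _ i 1 x hx (le_trans (by omega) (le_max_left _ _)))
  have f2 : ∀ i < k, i + N0 ≤ max k (max Na Nb) →
      lam₁ ^ (1 - ε/2) < |deriv (G.g γ) ((G.g γ)^[i] x)| ∧
      |deriv (G.g γ) ((G.g γ)^[i] x)| < lam₂ ^ (1 + ε/2) := fun i hi hle =>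
    hN0 γ hg _ (stay_shift _ _ _ i N0 x hx hle)
  have fpos : ∀ i < k, 0 < |deriv (G.g γ) ((G.g γ)^[i] x)| := fun i hi =>
    lt_of_lt_of_le hm (f1 i hi).1
  have ra := ha (max Na Nb) (le_max_left _ _) k hk
    (fun i => Real.log |deriv (G.g γ) ((G.g γ)^[i] x)|)
    (fun i hi => Real.log_le_log hm (f1 i hi).1)
    (fun i hi hle => by
      rw [← Real.log_rpow p1]
      exact Real.log_le_log (Real.rpow_pos_of_pos p1 _) (f2 i hi hle).1.le)
  have rb := hb (max Na Nb) (le_max_right _ _) k hk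
    (fun i => -Real.log |deriv (G.g γ) ((G.g γ)^[i] x)|)
    (fun i hi => neg_le_neg (Real.log_le_log (fpos i hi) (f1 i hi).2))
    (fun i hi hle => by
      rw [← Real.log_rpow p2]
      exact neg_le_neg (Real.log_le_log (fpos i hi) (f2 i hi hle).2.le))
  have hprod : |deriv ((G.g γ)^[k]) x| =
      ∏ i ∈ Finset.range k, |deriv (G.g γ) ((G.g γ)^[i] x)| := by
    rw [deriv_iter_prod _ ((G.smooth γ hγ).differentiable (by norm_num)), Finset.abs_prod]
  have hppos : 0 < |deriv ((G.g γ)^[k]) x| := by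
    rw [hprod]; exact Finset.prod_pos fun i hi => fpos i (Finset.mem_range.1 hi)
  have hlog : Real.log |deriv ((G.g γ)^[k]) x| =
      ∑ i ∈ Finset.range k, Real.log |deriv (G.g γ) ((G.g γ)^[i] x)| := by
    rw [hprod, Real.log_prod fun i hi => (fpos i (Finset.mem_range.1 hi)).ne']
  rw [Finset.sum_neg_distrib, ← hlog] at rb
  rw [← hlog] at ra
  constructor
  · rw [← Real.log_lt_log_iff (Real.rpow_pos_of_pos p1 _) hppos, Real.log_rpow p1]
    linarith
  · rw [← Real.log_lt_log_iff hppos (Real.rpow_pos_of_pos p2 _), Real.log_rpow p2]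
    linarith
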